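/- Let Σ = {1, 2, 3, 4}, let φ : Σ* → Σ* be the morphism determined by φ(4) = 43, φ(3) = 32, φ(2) = 21, φ(1) = 1, and let ψ be the coding with ψ(4) = 4, ψ(3) = 3, ψ(2) = 1, ψ(1) = 1. Then the morphic sequence β = ψ(φ^∞(4)) = 433131113111111311111111113… has subword complexity p_β(n) = Θ(n^(3/2)) as n → ∞. -/

import Mathlib

open Asymptotics Filter

/-- Apply a morphism (given by its values on letters) to a finite word. -/
def substWord {A : Type*} (φ : A → List A) : List A → List A
  | [] => []
  | a :: w => φ a ++ substWord φ w

/-- The `n`-th iterate of a morphism applied to a word. -/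
def iterWord {A : Type*} (φ : A → List A) (n : ℕ) (w : List A) : List A :=
  (substWord φ)^[n] w

/-- The subword complexity of an infinite word `β`: the number of distinct
factors of `β` of length `n`. -/
noncomputable def complexity {B : Type*} (β : ℕ → B) (n : ℕ) : ℕ :=
  Set.ncard {w : List B | ∃ i : ℕ, w = List.ofFn (fun j : Fin n => β (i + (j : ℕ)))}

/-- The alphabet `Σ = {1,2,3,4}` is encoded as `Fin 4`, with `i : Fin 4`
representing the letter `i+1`. The morphism `φ(4) = 43`, `φ(3) = 32`,
`φ(2) = 21`, `φ(1) = 1`. -/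
def phi19 : Fin 4 → List (Fin 4) := ![[0], [1, 0], [2, 1], [3, 2]]

/-- The coding `ψ(4) = 4`, `ψ(3) = 3`, `ψ(2) = 1`, `ψ(1) = 1` (letters encoded
as their value minus one in `Fin 4`). -/
def psi19 : Fin 4 → Fin 4 := ![0, 0, 2, 3]

theorem substWord_append {A : Type*} (φ : A → List A) (u v : List A) :
    substWord φ (u ++ v) = substWord φ u ++ substWord φ v := by
  induction u with
  | nil => rfl
  | cons a u ih => simp [substWord, ih]

theorem iterWord_succ {A : Type*} (φ : A → List A) (n : ℕ) (w : List A) :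
    iterWord φ (n + 1) w = iterWord φ n (substWord φ w) := rfl

theorem iterWord_append {A : Type*} (φ : A → List A) (n : ℕ) (u v : List A) :
    iterWord φ n (u ++ v) = iterWord φ n u ++ iterWord φ n v := by
  induction n generalizing u v with
  | zero => rfl
  | succ n ih => simp only [iterWord_succ, substWord_append, ih]

/-- The triangular numbers, which are the numbers of ones between consecutive threes. -/
def triangular : ℕ → ℕ
  | 0 => 0
  | n + 1 => triangular n + (n + 1)

/-- The position of the `n`-th letter three of the coded sequence. -/
def threePos : ℕ → ℕ
  | 0 => 1
  | n + 1 => threePos n + (triangular n + 1)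

theorem two_mul_triangular (n : ℕ) : 2 * triangular n = n * (n + 1) := by
  induction n with
  | zero => rfl
  | succ n ih => rw [triangular]; linarith

theorem six_mul_threePos (n : ℕ) : 6 * threePos n = n ^ 3 + 5 * n + 6 := by
  induction n with
  | zero => rfl
  | succ n ih =>
    have h := two_mul_triangular n
    rw [threePos]
    linarith

theorem triangular_strictMono : StrictMono triangular :=
  strictMono_nat_of_lt_succ fun n => by rw [triangular]; omega

theorem threePos_strictMono : StrictMono threePos :=
  strictMono_nat_of_lt_succ fun n => by rw [threePos]; omega

theorem iterWord_phi19_zero (n : ℕ) : iterWord phi19 n [0] = [0] := by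
  induction n with
  | zero => rfl
  | succ n ih => exact ih

theorem iterWord_phi19_one (n : ℕ) :
    iterWord phi19 n [1] = 1 :: List.replicate n 0 := by
  induction n with
  | zero => rfl
  | succ n ih =>
    have h : iterWord phi19 (n + 1) [1] = iterWord phi19 n ([1] ++ [0]) := rfl
    rw [h, iterWord_append, ih, iterWord_phi19_zero, List.replicate_succ']
    rfl

theorem map_psi19_iterWord_two (n : ℕ) :
    (iterWord phi19 n [2]).map psi19 = 2 :: List.replicate (triangular n) 0 := by
  induction n with
  | zero => rfl
  | succ n ih =>
    have h : iterWord phi19 (n + 1) [2] = iterWord phi19 n ([2] ++ [1]) := rfl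
    rw [h, iterWord_append, List.map_append, ih, iterWord_phi19_one, triangular,
      List.replicate_add, List.replicate_succ, List.map_cons, List.map_replicate]
    rfl

theorem length_iterWord_two (n : ℕ) :
    (iterWord phi19 n [2]).length = triangular n + 1 := by
  simpa using congrArg List.length (map_psi19_iterWord_two n)

theorem iterWord_three_succ (n : ℕ) :
    iterWord phi19 (n + 1) [3] = iterWord phi19 n [3] ++ iterWord phi19 n [2] :=
  iterWord_append phi19 n [3] [2]

theorem length_iterWord_three (n : ℕ) : (iterWord phi19 n [3]).length = threePos n := by
  induction n with
  | zero => rfl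
  | succ n ih => rw [iterWord_three_succ, List.length_append, ih, length_iterWord_two, threePos]

/-- The infinite word `4 3 1^{T_0} 3 1^{T_1} 3 1^{T_2} ⋯` with `T` the triangular numbers. -/
structure IsTriangularWord (β : ℕ → Fin 4) : Prop where
  head : β 0 = 3
  block (n j : ℕ) (hj : j < triangular n + 1) : β (threePos n + j) = if j = 0 then 2 else 0

theorem isTriangularWord_of_forall_iterWord {α : ℕ → Fin 4}
    (hα : ∀ (n i : ℕ) (h : i < (iterWord phi19 n [3]).length),
      (iterWord phi19 n [3]).get ⟨i, h⟩ = α i) :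
    IsTriangularWord fun i => psi19 (α i) where
  head := by
    have h : (3 : Fin 4) = α 0 := hα 0 0 Nat.one_pos
    simp [← h, psi19]
  block n j hj := by
    have hlt : threePos n + j < (iterWord phi19 (n + 1) [3]).length := by
      rw [length_iterWord_three, threePos]; omega
    have hj' : j < (iterWord phi19 n [2]).length := by rwa [length_iterWord_two]
    have hget : (iterWord phi19 n [2])[j] = α (threePos n + j) := by
      rw [← hα (n + 1) _ hlt]
      simp [iterWord_three_succ, List.getElem_append_right, length_iterWord_three]
    have hmap : psi19 (iterWord phi19 n [2])[j] =
        (2 :: List.replicate (triangular n) (0 : Fin 4))[j]'(by simpa using hj) := by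
      simp [← map_psi19_iterWord_two]
    rw [← hget, hmap]
    cases j <;> simp

theorem exists_eq_threePos_add {i : ℕ} (hi : 1 ≤ i) :
    ∃ k j, j < triangular k + 1 ∧ i = threePos k + j := by
  induction i, hi using Nat.le_induction with
  | base => exact ⟨0, 0, by omega, rfl⟩
  | succ i _ ih =>
    obtain ⟨k, j, hj, rfl⟩ := ih
    by_cases h : j + 1 < triangular k + 1
    · exact ⟨k, j + 1, h, rfl⟩
    · exact ⟨k + 1, 0, by omega, by rw [threePos]; omega⟩

theorem IsTriangularWord.apply_threePos {β : ℕ → Fin 4} (hβ : IsTriangularWord β) (k : ℕ) :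
    β (threePos k) = 2 := by
  simpa using hβ.block k 0 (by omega)

theorem IsTriangularWord.eq_zero_or_threePos {β : ℕ → Fin 4} (hβ : IsTriangularWord β) {i : ℕ}
    (hi : 1 ≤ i) : β i = 0 ∨ ∃ k, i = threePos k := by
  obtain ⟨k, j, hj, rfl⟩ := exists_eq_threePos_add hi
  rcases Nat.eq_zero_or_pos j with rfl | hpos
  · exact Or.inr ⟨k, rfl⟩
  · exact Or.inl (by rw [hβ.block k j hj, if_neg hpos.ne'])

theorem IsTriangularWord.exists_threePos {β : ℕ → Fin 4} (hβ : IsTriangularWord β) {i : ℕ}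
    (hi : β i = 2) : ∃ k, i = threePos k := by
  rcases Nat.eq_zero_or_pos i with rfl | hpos
  · exact absurd (hβ.head.symm.trans hi) (by decide)
  · exact (hβ.eq_zero_or_threePos hpos).resolve_left fun h => absurd (h.symm.trans hi) (by decide)

theorem exists_first_threePos (i : ℕ) :
    ∃ k, i ≤ threePos k ∧ (∀ m, i ≤ threePos m → k ≤ m) ∧ threePos (k + 1) < i + (k ^ 2 + 3) := by
  classical
  have hex : ∃ k, i ≤ threePos k := ⟨i, threePos_strictMono.le_apply⟩
  refine ⟨Nat.find hex, Nat.find_spec hex, fun m hm => Nat.find_min' hex hm, ?_⟩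
  rcases hk : Nat.find hex with _ | k
  · simp only [threePos, triangular]; omega
  · have hlt : threePos k < i := not_le.mp (Nat.find_min hex (by omega))
    have h := two_mul_triangular k
    have hsum : 2 * triangular k + (k + 1) = (k + 1) ^ 2 := by rw [h]; ring
    simp only [threePos, triangular]
    omega

theorem IsTriangularWord.window_injOn {β : ℕ → Fin 4} (hβ : IsTriangularWord β) {n K : ℕ}
    (hn : K ^ 2 + 3 ≤ n) {i i' : ℕ} (hi : i < threePos K) (hi' : i' < threePos K)
    (h : ∀ j < n, β (i + j) = β (i' + j)) : i = i' := by
  obtain ⟨k, hk, hmin, hlt⟩ := exists_first_threePos i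
  obtain ⟨k', hk', hmin', hlt'⟩ := exists_first_threePos i'
  have hkn : k ^ 2 ≤ K ^ 2 := Nat.pow_le_pow_left (hmin K hi.le) 2
  have hkn' : k' ^ 2 ≤ K ^ 2 := Nat.pow_le_pow_left (hmin' K hi'.le) 2
  have hs : threePos (k + 1) = threePos k + (triangular k + 1) := rfl
  have hs' : threePos (k' + 1) = threePos k' + (triangular k' + 1) := rfl
  have transfer (m : ℕ) (h1 : i ≤ threePos m) (h2 : threePos m < i + n) :
      ∃ l, i' + (threePos m - i) = threePos l := by
    apply hβ.exists_threePos
    rw [← h _ (by omega), Nat.add_sub_cancel' h1, hβ.apply_threePos]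
  have transfer' (m : ℕ) (h1 : i' ≤ threePos m) (h2 : threePos m < i' + n) :
      ∃ l, i + (threePos m - i') = threePos l := by
    apply hβ.exists_threePos
    rw [h _ (by omega), Nat.add_sub_cancel' h1, hβ.apply_threePos]
  obtain ⟨a, ha⟩ := transfer k hk (by omega)
  obtain ⟨b, hb⟩ := transfer (k + 1) (by omega) (by omega)
  obtain ⟨a', ha'⟩ := transfer' k' hk' (by omega)
  obtain ⟨b', hb'⟩ := transfer' (k' + 1) (by omega) (by omega)
  have hak := threePos_strictMono.monotone (hmin' a (by omega))
  have hak' := threePos_strictMono.monotone (hmin a' (by omega))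
  have hbk : threePos (k' + 1) ≤ threePos b :=
    threePos_strictMono.monotone (threePos_strictMono.lt_iff_lt.mp (by omega : _ < threePos b))
  have hbk' : threePos (k + 1) ≤ threePos b' :=
    threePos_strictMono.monotone (threePos_strictMono.lt_iff_lt.mp (by omega : _ < threePos b'))
  have hkk : k = k' := triangular_strictMono.injective (by omega)
  subst hkk
  omega

theorem IsTriangularWord.threePos_le_complexity {β : ℕ → Fin 4} (hβ : IsTriangularWord β)
    {n K : ℕ} (hn : K ^ 2 + 3 ≤ n) : threePos K ≤ complexity β n := by
  have hfin : {w : List (Fin 4) | ∃ i : ℕ, w = List.ofFn fun j : Fin n => β (i + (j : ℕ))}.Finite :=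
    (List.finite_length_eq (Fin 4) n).subset (by rintro w ⟨i, rfl⟩; simp)
  have hinj : Set.InjOn (fun i : ℕ => List.ofFn fun j : Fin n => β (i + (j : ℕ)))
      (Set.Iio (threePos K)) := fun i hi i' hi' h =>
    hβ.window_injOn hn hi hi' fun j hj => congrFun (List.ofFn_injective h) ⟨j, hj⟩
  calc threePos K = (Set.Iio (threePos K)).ncard := by simp
    _ = _ := hinj.ncard_image.symm
    _ ≤ complexity β n := Set.ncard_le_ncard (by rintro _ ⟨i, -, rfl⟩; exact ⟨i, rfl⟩) hfin

theorem IsTriangularWord.window_eq_of_threePos_le {β : ℕ → Fin 4} (hβ : IsTriangularWord β)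
    {n K i : ℕ} (hn : n ≤ triangular K + 1) (hi : threePos K ≤ i) :
    ∃ l < n + 1, ∀ j < n, β (i + j) = if j = l then 2 else 0 := by
  have hpos : 1 ≤ i := (threePos_strictMono.monotone (Nat.zero_le K)).trans hi
  by_cases hex : ∃ l < n, β (i + l) = 2
  · obtain ⟨l, hl, hl2⟩ := hex
    refine ⟨l, by omega, fun j hj => ?_⟩
    split_ifs with hjl
    · rw [hjl, hl2]
    · refine (hβ.eq_zero_or_threePos (by omega)).resolve_right ?_
      rintro ⟨b, hb⟩
      obtain ⟨a, ha⟩ := hβ.exists_threePos hl2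
      have gap {c d : ℕ} (hc : threePos K ≤ threePos c) (hcd : threePos c < threePos d) :
          threePos c + n ≤ threePos d := by
        have h1 := triangular_strictMono.monotone (threePos_strictMono.le_iff_le.mp hc)
        have h2 : threePos (c + 1) ≤ threePos d :=
          threePos_strictMono.monotone (threePos_strictMono.lt_iff_lt.mp hcd)
        rw [threePos] at h2
        omega
      rcases lt_or_gt_of_ne hjl with hlt | hlt
      · have := gap (c := b) (d := a) (by omega) (by omega)
        omega
      · have := gap (c := a) (d := b) (by omega) (by omega)
        omega
  · refine ⟨n, by omega, fun j hj => ?_⟩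
    rw [if_neg hj.ne]
    refine (hβ.eq_zero_or_threePos (by omega)).resolve_right ?_
    rintro ⟨b, hb⟩
    exact hex ⟨j, hj, by rw [hb, hβ.apply_threePos]⟩

theorem IsTriangularWord.complexity_le {β : ℕ → Fin 4} (hβ : IsTriangularWord β)
    {n K : ℕ} (hn : n ≤ triangular K + 1) : complexity β n ≤ threePos K + (n + 1) := by
  classical
  let s := (Finset.range (threePos K)).image
    fun i => List.ofFn fun j : Fin n => β (i + (j : ℕ))
  let t := (Finset.range (n + 1)).image
    fun l => List.ofFn fun j : Fin n => if (j : ℕ) = l then (2 : Fin 4) else 0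
  have hsub : {w : List (Fin 4) | ∃ i : ℕ, w = List.ofFn fun j : Fin n => β (i + (j : ℕ))} ⊆
      ((s ∪ t : Finset (List (Fin 4))) : Set (List (Fin 4))) := by
    rintro w ⟨i, rfl⟩
    rw [Finset.mem_coe, Finset.mem_union]
    rcases lt_or_ge i (threePos K) with hi | hi
    · exact Or.inl (Finset.mem_image.mpr ⟨i, Finset.mem_range.mpr hi, rfl⟩)
    · obtain ⟨l, hl, hw⟩ := hβ.window_eq_of_threePos_le hn hi
      exact Or.inr (Finset.mem_image.mpr ⟨l, Finset.mem_range.mpr hl,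
        congrArg List.ofFn (funext fun j => (hw j j.2).symm)⟩)
  calc complexity β n ≤ (s ∪ t).card := by
        rw [← Set.ncard_coe_finset]
        exact Set.ncard_le_ncard hsub (Finset.finite_toSet _)
    _ ≤ s.card + t.card := Finset.card_union_le _ _
    _ ≤ threePos K + (n + 1) := by
        gcongr
        · exact Finset.card_image_le.trans (Finset.card_range _).le
        · exact Finset.card_image_le.trans (Finset.card_range _).le

theorem IsTriangularWord.complexity_le_sqrt_pow {β : ℕ → Fin 4} (hβ : IsTriangularWord β)
    {n : ℕ} (hn : 1 ≤ n) : complexity β n ≤ 8 * n.sqrt ^ 3 := by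
  obtain ⟨s, hs⟩ : ∃ s, n.sqrt = s := ⟨_, rfl⟩
  have hs1 : 1 ≤ s := hs ▸ Nat.sqrt_pos.mpr hn
  have hlt : n < (s + 1) * (s + 1) := hs ▸ Nat.lt_succ_sqrt n
  have hT := two_mul_triangular (2 * s)
  have hP := six_mul_threePos (2 * s)
  have h := hβ.complexity_le (n := n) (K := 2 * s) (by nlinarith)
  have h2 : s ≤ s ^ 2 := by nlinarith
  have h3 : s ^ 2 ≤ s ^ 3 := Nat.pow_le_pow_right hs1 (by norm_num)
  rw [hs]
  nlinarith

theorem IsTriangularWord.sqrt_succ_pow_le_complexity {β : ℕ → Fin 4} (hβ : IsTriangularWord β)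
    {n : ℕ} (hn : 4 ≤ n) : (n.sqrt + 1) ^ 3 ≤ 162 * complexity β n := by
  have hs2 : 2 ≤ n.sqrt := Nat.le_sqrt.mpr hn
  have hle : n.sqrt * n.sqrt ≤ n := Nat.sqrt_le n
  obtain ⟨K, hK⟩ : ∃ K, n.sqrt = K + 1 := ⟨n.sqrt - 1, by omega⟩
  rw [hK] at hs2 hle ⊢
  have h := hβ.threePos_le_complexity (n := n) (K := K) (by nlinarith)
  have hP := six_mul_threePos K
  have h3 : (K + 1 + 1) ^ 3 ≤ (3 * K) ^ 3 := Nat.pow_le_pow_left (by omega) 3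
  rw [mul_pow] at h3
  omega

theorem IsTriangularWord.complexity_isTheta {β : ℕ → Fin 4} (hβ : IsTriangularWord β) :
    (fun n => (complexity β n : ℝ)) =Θ[atTop] (fun n : ℕ => (n : ℝ) ^ ((3 : ℝ) / 2)) := by
  have hpow (n : ℕ) : (n : ℝ) ^ ((3 : ℝ) / 2) = √(n : ℝ) ^ 3 := by
    rw [Real.sqrt_eq_rpow, ← Real.rpow_natCast, ← Real.rpow_mul n.cast_nonneg]
    norm_num
  constructor
  · refine IsBigO.of_bound 8 ?_
    filter_upwards [eventually_ge_atTop 1] with n hn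
    rw [hpow, Real.norm_of_nonneg (by positivity), Real.norm_of_nonneg (by positivity)]
    calc (complexity β n : ℝ) ≤ 8 * (n.sqrt : ℝ) ^ 3 := by
          exact_mod_cast hβ.complexity_le_sqrt_pow hn
      _ ≤ 8 * √(n : ℝ) ^ 3 := by gcongr; exact Real.nat_sqrt_le_real_sqrt
  · refine IsBigO.of_bound 162 ?_
    filter_upwards [eventually_ge_atTop 4] with n hn
    rw [hpow, Real.norm_of_nonneg (by positivity), Real.norm_of_nonneg (by positivity)]
    calc √(n : ℝ) ^ 3 ≤ ((n.sqrt : ℝ) + 1) ^ 3 := by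
          gcongr; exact Real.real_sqrt_le_nat_sqrt_succ
      _ ≤ 162 * (complexity β n : ℝ) := by
          exact_mod_cast hβ.sqrt_succ_pow_le_complexity hn

/-- The morphic sequence `β = ψ(φ^∞(4)) = 4331311131111113…` has subword
complexity `Θ(n^(3/2))`. -/
theorem stmt19 (α : ℕ → Fin 4)
    (hα : ∀ (n i : ℕ) (h : i < (iterWord phi19 n [3]).length),
      (iterWord phi19 n [3]).get ⟨i, h⟩ = α i) :
    (fun n => (complexity (fun i => psi19 (α i)) n : ℝ)) =Θ[atTop]
      (fun n => (n : ℝ) ^ ((3 : ℝ) / 2)) := by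
  exact (isTriangularWord_of_forall_iterWord hα).complexity_isTheta
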